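/- The curvature of the full connection of a generalised pp-wave with purely axial torsion is the sum of the Riemannian (Levi-Civita) curvature and the torsion-generated curvature: R[{Γ} + K]^κ_{λμν} = R[{Γ}]^κ_{λμν} + R[K]^κ_{λμν} for all κ, λ, μ, ν (i.e. all cross terms between {Γ} and K cancel). -/

import Mathlib

noncomputable section

open scoped BigOperators

/-- Points of spacetime: ℝ⁴ with coordinates x⁰, x¹, x², x³. -/
abbrev Spacetime := Fin 4 → ℝ

/-- Partial derivative ∂_μ of a scalar function. -/
def pd (μ : Fin 4) (h : Spacetime → ℝ) : Spacetime → ℝ :=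
  fun x => fderiv ℝ h x (Pi.single μ 1)

/-- The pp-metric g_{μν}: nonzero components g₀₃ = g₃₀ = 1, g₁₁ = g₂₂ = −1, g₃₃ = f. -/
def ppMetric (f : Spacetime → ℝ) (x : Spacetime) (μ ν : Fin 4) : ℝ :=
  if μ = 0 ∧ ν = 3 then 1 else if μ = 3 ∧ ν = 0 then 1
  else if μ = 1 ∧ ν = 1 then -1 else if μ = 2 ∧ ν = 2 then -1
  else if μ = 3 ∧ ν = 3 then f x else 0

/-- The pointwise inverse metric g^{μν}: g⁰⁰ = −f, g⁰³ = g³⁰ = 1, g¹¹ = g²² = −1. -/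
def ppMetricInv (f : Spacetime → ℝ) (x : Spacetime) (μ ν : Fin 4) : ℝ :=
  if μ = 0 ∧ ν = 0 then -(f x) else if μ = 0 ∧ ν = 3 then 1
  else if μ = 3 ∧ ν = 0 then 1
  else if μ = 1 ∧ ν = 1 then -1 else if μ = 2 ∧ ν = 2 then -1 else 0

/-- Christoffel symbols {Γ}^λ_{μν} = ½ g^{λκ}(∂_μ g_{κν} + ∂_ν g_{κμ} − ∂_κ g_{μν}). -/
def christoffel (f : Spacetime → ℝ) (x : Spacetime) (l μ ν : Fin 4) : ℝ :=
  (1/2) * ∑ κ, ppMetricInv f x l κ *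
    (pd μ (fun y => ppMetric f y κ ν) x + pd ν (fun y => ppMetric f y κ μ) x
      - pd κ (fun y => ppMetric f y μ ν) x)

/-- Totally antisymmetric symbol ε with ε₀₁₂₃ = 1. -/
def eps (a b c d : Fin 4) : ℝ :=
  ((((b:ℕ):ℝ) - ((a:ℕ):ℝ)) * (((c:ℕ):ℝ) - ((a:ℕ):ℝ)) * (((d:ℕ):ℝ) - ((a:ℕ):ℝ)) *
    (((c:ℕ):ℝ) - ((b:ℕ):ℝ)) * (((d:ℕ):ℝ) - ((b:ℕ):ℝ)) * (((d:ℕ):ℝ) - ((c:ℕ):ℝ))) / 12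

/-- Purely axial torsion T_{κμν} = k(x³) ε_{0κμν}. -/
def torsion (k : ℝ → ℝ) (x : Spacetime) (κ μ ν : Fin 4) : ℝ :=
  k (x 3) * eps 0 κ μ ν

/-- Contorsion K^κ_{μν} = ½ g^{κρ} T_{ρμν}. -/
def contorsion (f : Spacetime → ℝ) (k : ℝ → ℝ) (x : Spacetime) (κ μ ν : Fin 4) : ℝ :=
  (1/2) * ∑ ρ, ppMetricInv f x κ ρ * torsion k x ρ μ ν

/-- The full connection Γ^λ_{μν} = {Γ}^λ_{μν} + K^λ_{μν}. -/
def fullConn (f : Spacetime → ℝ) (k : ℝ → ℝ) (x : Spacetime) (κ μ ν : Fin 4) : ℝ :=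
  christoffel f x κ μ ν + contorsion f k x κ μ ν

/-- Curvature R[A]^κ_{λμν} of connection coefficients A^κ_{μν}. -/
def curv (A : Spacetime → Fin 4 → Fin 4 → Fin 4 → ℝ) (x : Spacetime)
    (κ l μ ν : Fin 4) : ℝ :=
  pd μ (fun y => A y κ ν l) x - pd ν (fun y => A y κ μ l) x
    + ∑ η, (A x κ μ η * A x η ν l - A x κ ν η * A x η μ l)

/-- The parallel null vector field l^μ = (1,0,0,0). -/
def lUp : Fin 4 → ℝ := fun μ => if μ = 0 then 1 else 0

/-- The lowered vector l_μ = g_{μν} l^ν = (0,0,0,1). -/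
def lCov : Fin 4 → ℝ := fun μ => if μ = 3 then 1 else 0

@[simp] theorem lCov_zero : lCov 0 = 0 := rfl

@[simp] theorem lCov_one : lCov 1 = 0 := rfl

@[simp] theorem lCov_two : lCov 2 = 0 := rfl

@[simp] theorem lCov_three : lCov 3 = 1 := rfl

theorem pd_add {μ : Fin 4} {u v : Spacetime → ℝ} {x : Spacetime}
    (hu : DifferentiableAt ℝ u x) (hv : DifferentiableAt ℝ v x) :
    pd μ (fun y => u y + v y) x = pd μ u x + pd μ v x := by
  simp [pd, fderiv_fun_add hu hv]

theorem pd_ppMetric (f : Spacetime → ℝ) (x : Spacetime) (μ κ ν : Fin 4) :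
    pd μ (fun y => ppMetric f y κ ν) x = lCov κ * lCov ν * pd μ f x := by
  fin_cases κ <;> fin_cases ν <;> simp [pd, ppMetric]

theorem differentiable_pd {f : Spacetime → ℝ} (hf : ContDiff ℝ (⊤ : ℕ∞) f) (μ : Fin 4) :
    Differentiable ℝ (pd μ f) :=
  (((contDiff_infty_iff_fderiv.mp hf).2).differentiable (by simp)).clm_apply
    (differentiable_const _)

theorem differentiable_ppMetricInv {f : Spacetime → ℝ} (hf : Differentiable ℝ f)
    (μ ν : Fin 4) : Differentiable ℝ (fun x => ppMetricInv f x μ ν) := by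
  unfold ppMetricInv
  split_ifs <;> fun_prop

theorem differentiable_christoffel {f : Spacetime → ℝ} (hf : ContDiff ℝ (⊤ : ℕ∞) f)
    (κ μ ν : Fin 4) : Differentiable ℝ (fun x => christoffel f x κ μ ν) := by
  have hpd := differentiable_pd hf
  have hinv := differentiable_ppMetricInv (hf.differentiable (by simp))
  simp only [christoffel, pd_ppMetric]
  fun_prop

theorem differentiable_contorsion {f : Spacetime → ℝ} (hf : Differentiable ℝ f)
    {k : ℝ → ℝ} (hk : Differentiable ℝ k) (κ μ ν : Fin 4) :
    Differentiable ℝ (fun x => contorsion f k x κ μ ν) := by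
  have hinv := differentiable_ppMetricInv hf
  unfold contorsion torsion
  fun_prop

/-- Christoffel symbols of a pp-metric whose profile does not depend on `x⁰`. -/
theorem christoffel_eq {f : Spacetime → ℝ} (h0 : ∀ x, pd 0 f x = 0) (x : Spacetime)
    (κ μ ν : Fin 4) :
    christoffel f x κ μ ν =
      (1 / 2) * (lUp κ * (lCov ν * pd μ f x + lCov μ * pd ν f x)
        + lCov μ * lCov ν * ![-pd 3 f x, pd 1 f x, pd 2 f x, 0] κ) := by
  simp only [christoffel, pd_ppMetric, Fin.sum_univ_four]
  fin_cases κ <;> simp [ppMetricInv, lUp, h0] <;> ring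

/-- The contorsion does not depend on the profile `f` of the pp-metric. -/
theorem contorsion_eq (f : Spacetime → ℝ) (k : ℝ → ℝ) (x : Spacetime) (κ μ ν : Fin 4) :
    contorsion f k x κ μ ν =
      (1 / 2) * k (x 3) * ![eps 0 3 μ ν, -eps 0 1 μ ν, -eps 0 2 μ ν, 0] κ := by
  have h (a b : Fin 4) : eps 0 0 a b = 0 := by simp [eps]
  simp only [contorsion, torsion, Fin.sum_univ_four]
  fin_cases κ <;> simp [ppMetricInv, h] <;> ring

theorem lCov_mul_eps_sub {i : Fin 4} (hi : i ≠ 3) (l μ ν : Fin 4) :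
    lCov μ * eps 0 i ν l - lCov ν * eps 0 i μ l =
      lCov l * (lCov ν * eps 0 3 μ i - lCov μ * eps 0 3 ν i) := by
  fin_cases i <;> fin_cases l <;> fin_cases μ <;> fin_cases ν <;>
    simp [eps] at hi ⊢ <;> norm_num

theorem eps_zero_one_two (ν : Fin 4) : eps 0 1 ν 2 = -lCov ν := by
  fin_cases ν <;> simp [eps] <;> norm_num

theorem eps_zero_two_one (ν : Fin 4) : eps 0 2 ν 1 = lCov ν := by
  fin_cases ν <;> simp [eps] <;> norm_num

theorem eps_eq_zero_of_first_eq_last (a b c : Fin 4) : eps a b c a = 0 := by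
  simp [eps]

theorem eps_eq_zero_of_second_eq_last (a b c : Fin 4) : eps a b c b = 0 := by
  simp [eps]

theorem christoffel_contorsion_cross_terms {f : Spacetime → ℝ} (h0 : ∀ x, pd 0 f x = 0)
    (k : ℝ → ℝ) (x : Spacetime) (κ l μ ν : Fin 4) :
    ∑ η, (christoffel f x κ μ η * contorsion f k x η ν l
      + contorsion f k x κ μ η * christoffel f x η ν l
      - christoffel f x κ ν η * contorsion f k x η μ l
      - contorsion f k x κ ν η * christoffel f x η μ l) = 0 := by
  simp only [christoffel_eq h0, contorsion_eq, Fin.sum_univ_four]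
  have h1 := lCov_mul_eps_sub (i := 1) (by decide) l μ ν
  have h2 := lCov_mul_eps_sub (i := 2) (by decide) l μ ν
  fin_cases κ <;> simp [lUp, h0, eps_eq_zero_of_first_eq_last, eps_eq_zero_of_second_eq_last,
    eps_zero_one_two, eps_zero_two_one]
  · linear_combination -(1 / 4) * k (x 3) * (pd 1 f x * h1 + pd 2 f x * h2)
  · ring
  · ring

/-- the curvature of the full connection is the sum of the Riemannian
curvature and the torsion-generated curvature. -/
theorem curvature_splits_into_riemann_plus_torsion
    (f : Spacetime → ℝ) (hf : ContDiff ℝ (⊤ : ℕ∞) f) (h0 : ∀ x, pd 0 f x = 0)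
    (k : ℝ → ℝ) (hk : ContDiff ℝ (⊤ : ℕ∞) k) :
    ∀ (x : Spacetime) (κ lam μ ν : Fin 4),
      curv (fullConn f k) x κ lam μ ν =
        curv (christoffel f) x κ lam μ ν + curv (contorsion f k) x κ lam μ ν := by
  intro x κ lam μ ν
  have hd (a b c : Fin 4) := differentiable_christoffel hf a b c x
  have hc (a b c : Fin 4) := differentiable_contorsion (hf.differentiable (by simp))
    (hk.differentiable (by simp)) a b c x
  have hcross := christoffel_contorsion_cross_terms h0 k x κ lam μ ν
  simp only [curv, fullConn, pd_add (hd _ _ _) (hc _ _ _)]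
  simp only [Fin.sum_univ_four] at hcross ⊢
  linear_combination hcross
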